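/- arXiv:2312.04038 — 2 statements merged into one kernel-verified Lean document; each statement's English description precedes it below -/
import Mathlib

section
/- Let d ≥ 1, T > 0, and let μ be a probability measure on ℝ supported on [0,T] whose density p is continuous and strictly positive on [0,T]. Let x, y : [0,T] → ℝ^d be injective continuously differentiable curves with ‖x'(t)‖ > 0 and ‖y'(t)‖ > 0 for all t ∈ [0,T], satisfying x(0) = y(0). If the pushforward measures of μ under x and under y coincide (Measure.map x μ = Measure.map y μ as measures on ℝ^d), then x(t) = y(t) for all t ∈ [0,T]. -/
open Set MeasureTheory

/-- One-sided comparison of two curves with the same pushforward. -/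
lemma one_sided_aux {E : Type*} [MetricSpace E] [MeasurableSpace E] [BorelSpace E]
    (T : ℝ) (hT : 0 < T) (μ : Measure ℝ) [IsProbabilityMeasure μ]
    (hsupp : μ (Icc 0 T)ᶜ = 0)
    (hpos : ∀ a b, a < b → Ioo a b ⊆ Icc 0 T → μ (Ioo a b) ≠ 0)
    (x y : ℝ → E) (hx_inj : InjOn x (Icc 0 T)) (hy_inj : InjOn y (Icc 0 T))
    (hx : ContinuousOn x (Icc 0 T)) (hy : ContinuousOn y (Icc 0 T))
    (hxm : AEMeasurable x μ) (hym : AEMeasurable y μ)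
    (h0 : x 0 = y 0) (hmap : Measure.map x μ = Measure.map y μ) :
    ∀ t ∈ Icc (0:ℝ) T, ∃ s ∈ Icc (0:ℝ) T, t ≤ s ∧ y t = x s := by
  have hK : IsCompact (x '' Icc 0 T) := isCompact_Icc.image_of_continuousOn hx
  have hsub : ∀ t ∈ Icc (0:ℝ) T, y t ∈ x '' Icc 0 T := by
    intro t ht
    by_contra hn
    have hnull : μ (y ⁻¹' (x '' Icc 0 T)ᶜ) = 0 := by
      rw [← Measure.map_apply_of_aemeasurable hym hK.isClosed.measurableSet.compl, ← hmap,
        Measure.map_apply_of_aemeasurable hxm hK.isClosed.measurableSet.compl]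
      refine measure_mono_null ?_ hsupp
      intro u hu hu'
      exact hu ⟨u, hu', rfl⟩
    have hnb : y ⁻¹' (x '' Icc 0 T)ᶜ ∈ nhdsWithin t (Icc 0 T) :=
      (hy t ht) (hK.isClosed.isOpen_compl.mem_nhds hn)
    obtain ⟨U, hU, htU, hUs⟩ := mem_nhdsWithin.1 hnb
    have htc : t ∈ closure (Ioo 0 T) := by rwa [closure_Ioo hT.ne]
    obtain ⟨u, huU, huI⟩ := mem_closure_iff.1 htc U hU htU
    obtain ⟨a, b, hab, habs⟩ := mem_nhds_iff_exists_Ioo_subset.1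
      ((hU.inter isOpen_Ioo).mem_nhds ⟨huU, huI⟩)
    refine hpos a b (hab.1.trans hab.2)
      (fun v hv => Ioo_subset_Icc_self (habs hv).2) (measure_mono_null ?_ hnull)
    intro v hv
    exact hUs ⟨(habs hv).1, Ioo_subset_Icc_self (habs hv).2⟩
  choose! φ hφI hφ using hsub
  have h0I : (0:ℝ) ∈ Icc 0 T := ⟨le_rfl, hT.le⟩
  have hTI : T ∈ Icc 0 T := ⟨hT.le, le_rfl⟩
  have hφ0 : φ 0 = 0 := hx_inj (hφI 0 h0I) h0I ((hφ 0 h0I).trans h0.symm)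
  have hφinj : InjOn φ (Icc 0 T) := by
    intro a ha b hb hab
    apply hy_inj ha hb
    rw [← hφ a ha, ← hφ b hb, hab]
  have hφc : ContinuousOn φ (Icc 0 T) := by
    have hemb : Topology.IsClosedEmbedding ((Icc 0 T).restrict x) :=
      Continuous.isClosedEmbedding (continuousOn_iff_continuous_restrict.1 hx)
        (injOn_iff_injective.1 hx_inj)
    rw [continuousOn_iff_continuous_restrict]
    have h1 : Continuous (fun u : Icc (0:ℝ) T => (⟨φ u, hφI u u.2⟩ : Icc (0:ℝ) T)) := by
      rw [hemb.isEmbedding.continuous_iff]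
      convert continuousOn_iff_continuous_restrict.1 hy using 1
      ext u
      exact hφ u u.2
    exact continuous_subtype_val.comp h1
  have hmono : StrictMonoOn φ (Icc 0 T) := by
    rcases hφc.strictMonoOn_of_injOn_Icc' hT.le hφinj with h | h
    · exact h
    · have := h h0I hTI hT
      have h2 := (hφI T hTI).1
      linarith
  intro t ht
  refine ⟨φ t, hφI t ht, ?_, (hφ t ht).symm⟩
  by_contra! hlt
  have hsI := hφI t ht
  have hC : IsCompact (x '' Icc 0 (φ t)) :=
    isCompact_Icc.image_of_continuousOn (hx.mono (Icc_subset_Icc_right hsI.2))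
  have h1 : μ (Icc 0 t) ≤ Measure.map y μ (x '' Icc 0 (φ t)) := by
    rw [Measure.map_apply_of_aemeasurable hym hC.isClosed.measurableSet]
    refine measure_mono ?_
    intro u hu
    have huI : u ∈ Icc 0 T := ⟨hu.1, hu.2.trans ht.2⟩
    exact ⟨φ u, ⟨(hφI u huI).1, hmono.monotoneOn huI ht hu.2⟩, hφ u huI⟩
  have h2 : Measure.map x μ (x '' Icc 0 (φ t)) ≤ μ (Icc 0 (φ t)) := by
    rw [Measure.map_apply_of_aemeasurable hxm hC.isClosed.measurableSet]
    calc μ (x ⁻¹' (x '' Icc 0 (φ t))) ≤ μ (Icc 0 (φ t) ∪ (Icc 0 T)ᶜ) := by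
          refine measure_mono ?_
          rintro u ⟨v, hv, hvu⟩
          by_cases hu : u ∈ Icc 0 T
          · left
            rwa [← hx_inj ⟨hv.1, hv.2.trans hsI.2⟩ hu hvu]
          · exact Or.inr hu
      _ ≤ μ (Icc 0 (φ t)) + μ (Icc 0 T)ᶜ := measure_union_le _ _
      _ = μ (Icc 0 (φ t)) := by rw [hsupp, add_zero]
  rw [hmap] at h2
  have h3 : μ (Icc 0 (φ t)) + μ (Ioo (φ t) t) ≤ μ (Icc 0 t) := by
    rw [← measure_union _ measurableSet_Ioo]
    · refine measure_mono (union_subset (Icc_subset_Icc_right hlt.le) ?_)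
      intro v hv
      exact ⟨hsI.1.trans hv.1.le, hv.2.le⟩
    · rw [Set.disjoint_left]
      intro v hv hv'
      exact absurd hv.2 (not_le.2 hv'.1)
  have h4 : μ (Icc 0 (φ t)) + μ (Ioo (φ t) t) ≤ μ (Icc 0 (φ t)) + 0 := by
    rw [add_zero]; exact h3.trans (h1.trans h2)
  have h5 := (ENNReal.add_le_add_iff_left (measure_ne_top μ _)).1 h4
  refine hpos _ _ hlt ?_ (le_antisymm h5 zero_le)
  intro v hv
  exact ⟨hsI.1.trans hv.1.le, hv.2.le.trans ht.2⟩

/-- **Theorem 2.1 (uniqueness of the trajectory).**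
Let `d ≥ 1`, `T > 0`, and let `μ` be a probability measure on `ℝ` supported on `[0,T]`
whose density `p` (w.r.t. Lebesgue measure) is continuous and strictly positive on `[0,T]`.
Let `x, y : [0,T] → ℝ^d` be injective `C¹` curves with nowhere vanishing derivative
satisfying `x 0 = y 0`.  If the pushforward measures of `μ` under `x` and under `y`
coincide, then `x = y` on `[0,T]`. -/
theorem unique_trajectory_from_distribution
    (d : ℕ) (hd : 1 ≤ d) (T : ℝ) (hT : 0 < T)
    (μ : Measure ℝ) [IsProbabilityMeasure μ] (p : ℝ → ℝ)
    (hμ : μ = volume.withDensity (fun t => ENNReal.ofReal (p t)))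
    (hp_cont : ContinuousOn p (Icc 0 T))
    (hp_pos : ∀ t ∈ Icc (0:ℝ) T, 0 < p t)
    (hp_supp : ∀ t, t ∉ Icc (0:ℝ) T → p t = 0)
    (x y x' y' : ℝ → EuclideanSpace ℝ (Fin d))
    (hx_inj : InjOn x (Icc 0 T)) (hy_inj : InjOn y (Icc 0 T))
    (hx_deriv : ∀ t ∈ Icc (0:ℝ) T, HasDerivWithinAt x (x' t) (Icc 0 T) t)
    (hx'_cont : ContinuousOn x' (Icc 0 T))
    (hx'_pos : ∀ t ∈ Icc (0:ℝ) T, 0 < ‖x' t‖)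
    (hy_deriv : ∀ t ∈ Icc (0:ℝ) T, HasDerivWithinAt y (y' t) (Icc 0 T) t)
    (hy'_cont : ContinuousOn y' (Icc 0 T))
    (hy'_pos : ∀ t ∈ Icc (0:ℝ) T, 0 < ‖y' t‖)
    (h0 : x 0 = y 0)
    (hmap : Measure.map x μ = Measure.map y μ) :
    ∀ t ∈ Icc (0:ℝ) T, x t = y t := by
  have hsupp : μ (Icc 0 T)ᶜ = 0 := by
    rw [hμ, withDensity_apply _ measurableSet_Icc.compl]
    rw [setLIntegral_congr_fun (g := fun _ => 0) measurableSet_Icc.compl]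
    · simp
    · intro t ht
      simp [hp_supp t ht]
  have hpos : ∀ a b, a < b → Ioo a b ⊆ Icc 0 T → μ (Ioo a b) ≠ 0 := by
    intro a b hab hs h
    rw [hμ, withDensity_apply _ measurableSet_Ioo] at h
    have hm : AEMeasurable (fun t => ENNReal.ofReal (p t)) (volume.restrict (Ioo a b)) :=
      ((hp_cont.mono hs).aemeasurable measurableSet_Ioo).ennreal_ofReal
    rw [lintegral_eq_zero_iff' hm] at h
    have h2 : ∀ᵐ t ∂(volume.restrict (Ioo a b)), False := by
      filter_upwards [h, ae_restrict_mem measurableSet_Ioo] with t ht htm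
      have := hp_pos t (hs htm)
      simp only [Pi.zero_apply, ENNReal.ofReal_eq_zero] at ht
      linarith
    rw [Filter.eventually_false_iff_eq_bot, ae_eq_bot, Measure.restrict_eq_zero,
      Real.volume_Ioo, ENNReal.ofReal_eq_zero] at h2
    linarith
  have hres : μ.restrict (Icc 0 T) = μ := Measure.restrict_eq_self_of_ae_mem hsupp
  have hx : ContinuousOn x (Icc 0 T) := fun t ht => (hx_deriv t ht).continuousWithinAt
  have hy : ContinuousOn y (Icc 0 T) := fun t ht => (hy_deriv t ht).continuousWithinAt
  have hxm : AEMeasurable x μ := by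
    rw [← hres]; exact hx.aemeasurable measurableSet_Icc
  have hym : AEMeasurable y μ := by
    rw [← hres]; exact hy.aemeasurable measurableSet_Icc
  intro t ht
  obtain ⟨s, hs, hts, hys⟩ := one_sided_aux T hT μ hsupp hpos x y hx_inj hy_inj hx hy hxm hym
    h0 hmap t ht
  obtain ⟨r, hr, hsr, hxr⟩ := one_sided_aux T hT μ hsupp hpos y x hy_inj hx_inj hy hx hym hxm
    h0.symm hmap.symm s hs
  have hrt : t = r := hy_inj ht hr (hys.trans hxr)
  have hst : s = t := le_antisymm (by rw [hrt]; exact hsr) hts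
  rw [hys, hst]
end

section
/- Let r : [0,T] → ℝ^d be an injective continuously differentiable unit-speed curve (‖r'(t)‖ = 1 for all t), let r̃ : [0,T₁] → ℝ^d be a continuously differentiable unit-speed curve with the same image {r(t) : t ∈ [0,T]} = {r̃(t) : t ∈ [0,T₁]}, and suppose t₁ ∈ [0, min(T, T₁)) satisfies r(t₁) = r̃(t₁). If for every Δt > 0 with t₁ + Δt ≤ min(T, T₁) the sets {r(t₁ + t) : t ∈ (0, Δt]} and {r̃(t₁ + t) : t ∈ (0, Δt]} intersect, then there exists Δt₁ > 0 such that r(t) = r̃(t) for all t ∈ [t₁, t₁ + Δt₁]. -/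
open Set MeasureTheory

lemma reparam_deriv {f g φ : ℝ → ℝ} {A B : Set ℝ} {s₀ c : ℝ}
    (hfg : ∀ s ∈ A, f (φ s) = g s) (hs₀ : s₀ ∈ A) (hmaps : MapsTo φ A B)
    (hφ : ContinuousWithinAt φ A s₀)
    (hf : HasDerivWithinAt f 1 B (φ s₀)) (hg : HasDerivWithinAt g c A s₀) :
    HasDerivWithinAt φ c A s₀ := by
  rw [hasDerivWithinAt_iff_isLittleO] at hf hg ⊢
  have ht : Filter.Tendsto φ (nhdsWithin s₀ A) (nhdsWithin (φ s₀) B) :=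
    hφ.tendsto_nhdsWithin hmaps
  have h1 : (fun s => g s - g s₀ - (φ s - φ s₀)) =o[nhdsWithin s₀ A]
      (fun s => φ s - φ s₀) := by
    refine (hf.comp_tendsto ht).congr' ?_ Filter.EventuallyEq.rfl
    filter_upwards [self_mem_nhdsWithin] with s hs
    simp [hfg s hs, hfg s₀ hs₀]
  have h2 : (fun s => g s - g s₀) =O[nhdsWithin s₀ A] (fun s => s - s₀) := by
    have := hg.isBigO.add (Asymptotics.isBigO_const_mul_self c (fun s => s - s₀) (nhdsWithin s₀ A))
    refine this.congr_left ?_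
    intro s
    simp only [smul_eq_mul]
    ring
  have h3 : (fun s => φ s - φ s₀) =O[nhdsWithin s₀ A] (fun s => g s - g s₀) := by
    have := h1.right_isBigO_add
    refine this.congr_right ?_
    intro s
    ring
  have h4 := h1.trans_isBigO (h3.trans h2)
  refine (hg.sub h4).congr_left ?_
  intro s
  ring

/-- **Second claim in the proof of Lemma A.3.**
Under the standing hypotheses of Lemma A.3 (equal images, `r` injective, both curves
unit-speed `C¹`), if `t₁ ∈ [0, min T T₁)` is a common point (`r t₁ = rt t₁`) and the
forward traces `{r (t₁+t) : t ∈ (0,Δt]}` and `{rt (t₁+t) : t ∈ (0,Δt]}` intersect for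
every admissible `Δt > 0`, then the two curves coincide on a right neighborhood
`[t₁, t₁ + Δt₁]` of `t₁`. -/
theorem curves_coincide_near_common_point
    (d : ℕ) (T T₁ : ℝ) (hT : 0 < T) (hT₁ : 0 < T₁)
    (r r' rt rt' : ℝ → EuclideanSpace ℝ (Fin d))
    (hr_inj : InjOn r (Icc 0 T))
    (hr_deriv : ∀ t ∈ Icc (0:ℝ) T, HasDerivWithinAt r (r' t) (Icc 0 T) t)
    (hr'_cont : ContinuousOn r' (Icc 0 T))
    (hr'_unit : ∀ t ∈ Icc (0:ℝ) T, ‖r' t‖ = 1)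
    (hrt_deriv : ∀ t ∈ Icc (0:ℝ) T₁, HasDerivWithinAt rt (rt' t) (Icc 0 T₁) t)
    (hrt'_cont : ContinuousOn rt' (Icc 0 T₁))
    (hrt'_unit : ∀ t ∈ Icc (0:ℝ) T₁, ‖rt' t‖ = 1)
    (himg : r '' Icc 0 T = rt '' Icc 0 T₁)
    (t₁ : ℝ) (ht₁ : t₁ ∈ Ico (0:ℝ) (min T T₁))
    (heq : r t₁ = rt t₁)
    (hinter : ∀ Δt > (0:ℝ), t₁ + Δt ≤ min T T₁ →
      (r '' Ioc t₁ (t₁ + Δt) ∩ rt '' Ioc t₁ (t₁ + Δt)).Nonempty) :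
    ∃ Δt₁ > (0:ℝ), t₁ + Δt₁ ≤ min T T₁ ∧
      ∀ t ∈ Icc t₁ (t₁ + Δt₁), r t = rt t := by
  have hrc : ContinuousOn r (Icc 0 T) := fun t ht => (hr_deriv t ht).continuousWithinAt
  have hrtc : ContinuousOn rt (Icc 0 T₁) := fun t ht => (hrt_deriv t ht).continuousWithinAt
  have hex : ∀ s : Icc (0:ℝ) T₁, ∃ u : Icc (0:ℝ) T, r u = rt s := by
    intro s
    have : rt s ∈ r '' Icc 0 T := by rw [himg]; exact mem_image_of_mem _ s.2
    obtain ⟨u, hu, h⟩ := this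
    exact ⟨⟨u, hu⟩, h⟩
  choose φ₀ hφ₀ using hex
  have hemb : Topology.IsClosedEmbedding ((Icc (0:ℝ) T).restrict r) :=
    hrc.restrict.isClosedEmbedding (injOn_iff_injective.1 hr_inj)
  have hφ₀c : Continuous φ₀ := by
    rw [hemb.isInducing.continuous_iff]
    have : (Icc (0:ℝ) T).restrict r ∘ φ₀ = (Icc (0:ℝ) T₁).restrict rt := by
      funext s; exact hφ₀ s
    rw [this]
    exact hrtc.restrict
  obtain ⟨φ, hφc, hφm, hφ⟩ : ∃ φ : ℝ → ℝ, Continuous φ ∧ MapsTo φ (Icc 0 T₁) (Icc 0 T) ∧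
      ∀ s ∈ Icc (0:ℝ) T₁, r (φ s) = rt s := by
    refine ⟨fun s => φ₀ (projIcc 0 T₁ hT₁.le s), ?_, ?_, ?_⟩
    · exact continuous_subtype_val.comp (hφ₀c.comp continuous_projIcc)
    · intro s _; exact (φ₀ _).2
    · intro s hs
      rw [hφ₀, projIcc_of_mem _ hs]
  have hd : ∀ s ∈ Icc (0:ℝ) T₁,
      HasDerivWithinAt φ (inner ℝ (r' (φ s)) (rt' s)) (Icc 0 T₁) s := by
    intro s hs
    refine reparam_deriv (f := fun u => inner ℝ (r' (φ s)) (r u))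
      (g := fun u => inner ℝ (r' (φ s)) (rt u)) (B := Icc 0 T) ?_ hs hφm
      hφc.continuousWithinAt ?_ ?_
    · intro u hu
      simp only [hφ u hu]
    · have := (innerSL ℝ (r' (φ s))).hasFDerivAt.comp_hasDerivWithinAt (φ s)
        (hr_deriv (φ s) (hφm hs))
      simpa [Function.comp_def, hr'_unit _ (hφm hs)] using this
    · have := (innerSL ℝ (r' (φ s))).hasFDerivAt.comp_hasDerivWithinAt s (hrt_deriv s hs)
      simpa [Function.comp_def] using this
  have hsq : ∀ s ∈ Icc (0:ℝ) T₁, (inner ℝ (r' (φ s)) (rt' s)) ^ 2 = (1:ℝ) := by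
    intro s hs
    have h1 : HasDerivWithinAt rt (inner ℝ (r' (φ s)) (rt' s) • r' (φ s)) (Icc 0 T₁) s := by
      refine ((hr_deriv (φ s) (hφm hs)).scomp s (hd s hs) hφm).congr ?_ ?_
      · intro u hu; exact (hφ u hu).symm
      · exact (hφ s hs).symm
    have h2 := (uniqueDiffOn_Icc hT₁ s hs).eq_deriv _ h1 (hrt_deriv s hs)
    have h3 := congrArg norm h2
    rw [norm_smul, hr'_unit _ (hφm hs), hrt'_unit s hs, mul_one, Real.norm_eq_abs] at h3
    rw [← sq_abs, h3]; norm_num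
  have hcc : ContinuousOn (fun s => (inner ℝ (r' (φ s)) (rt' s) : ℝ)) (Icc 0 T₁) :=
    (hr'_cont.comp hφc.continuousOn hφm).inner hrt'_cont
  have ht₁' : t₁ ∈ Icc (0:ℝ) T₁ := ⟨ht₁.1, (ht₁.2.trans_le (min_le_right _ _)).le⟩
  have ht₁T : t₁ ∈ Icc (0:ℝ) T := ⟨ht₁.1, (ht₁.2.trans_le (min_le_left _ _)).le⟩
  have hφt : φ t₁ = t₁ := hr_inj (hφm ht₁') ht₁T (by rw [hφ t₁ ht₁', heq])
  have hlin : ∀ c : ℝ, (∀ s ∈ Icc (0:ℝ) T₁, (inner ℝ (r' (φ s)) (rt' s) : ℝ) = c) →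
      ∀ s ∈ Icc (0:ℝ) T₁, φ s - c * s = t₁ - c * t₁ := by
    intro c hc s hs
    have hz : ∀ u ∈ Icc (0:ℝ) T₁,
        HasDerivWithinAt (fun u => φ u - c * u) 0 (Icc 0 T₁) u := by
      intro u hu
      have h := (hd u hu).sub ((hasDerivWithinAt_id u (Icc 0 T₁)).const_mul c)
      rw [hc u hu, mul_one, sub_self] at h
      exact h
    have := (convex_Icc (0:ℝ) T₁).norm_image_sub_le_of_norm_hasDerivWithin_le
      (C := 0) hz (by simp) ht₁' hs
    rw [zero_mul, norm_le_zero_iff, hφt] at this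
    linarith
  have hδ : 0 < min T T₁ - t₁ := sub_pos.2 ht₁.2
  rcases isPreconnected_Icc.eq_one_or_eq_neg_one_of_sq_eq hcc (fun s hs => by
    simpa using hsq s hs) with h | h
  · refine ⟨min T T₁ - t₁, hδ, by linarith, ?_⟩
    intro t ht
    have htm : t ≤ min T T₁ := by linarith [ht.2]
    have ht' : t ∈ Icc (0:ℝ) T₁ := ⟨ht₁.1.trans ht.1, htm.trans (min_le_right _ _)⟩
    have := hlin 1 (fun s hs => by simpa using h hs) t ht'
    have h2 : φ t = t := by linarith
    rw [← hφ t ht', h2]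
  · exfalso
    obtain ⟨x, ⟨a, ha, hax⟩, ⟨b, hb, hbx⟩⟩ := hinter _ hδ (by linarith)
    have ham : a ≤ min T T₁ := by linarith [ha.2]
    have hbm : b ≤ min T T₁ := by linarith [hb.2]
    have hb' : b ∈ Icc (0:ℝ) T₁ := ⟨ht₁.1.trans hb.1.le, hbm.trans (min_le_right _ _)⟩
    have ha' : a ∈ Icc (0:ℝ) T := ⟨ht₁.1.trans ha.1.le, ham.trans (min_le_left _ _)⟩
    have hab : φ b = a := hr_inj (hφm hb') ha' (by rw [hφ b hb', hax, hbx])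
    have := hlin (-1) (fun s hs => by simpa using h hs) b hb'
    linarith [ha.1, hb.1]
end
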